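/- arXiv:2012.00725 — 2 statements merged into one kernel-verified Lean document; each statement's English description precedes it below -/
import Mathlib

section
/- Let u₁,…,u_d be an orthonormal basis of ℂ^d, let λ₁ ≥ λ₂ ≥ ⋯ ≥ λ_d ≥ 0 be reals, and set f = Σ_{j=1}^{d} λ_j·u_j u_jᴴ. Then for every d×d complex matrix T with rank(T) ≤ k (0 ≤ k ≤ d), Re(trace((I_d − T)·f·(I_d − T)ᴴ)) ≥ Σ_{j=k+1}^{d} λ_j. Hence the orthogonal projection T = Σ_{j=1}^{k} u_j u_jᴴ minimizes trace((I_d − T)·f·(I_d − T)ᴴ) among all matrices of rank at most k, with minimum value Σ_{j=k+1}^{d} λ_j. -/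
open Matrix

section Projection

variable {𝕜 E ι : Type*} [RCLike 𝕜] [NormedAddCommGroup E] [InnerProductSpace 𝕜 E]

theorem norm_sq_le_norm_sq_starProjection_add (W : Submodule 𝕜 E) [W.HasOrthogonalProjection]
    (x : E) {w : E} (hw : w ∈ W) :
    ‖x‖ ^ 2 ≤ ‖W.starProjection x‖ ^ 2 + ‖x - w‖ ^ 2 := by
  have hproj : Wᗮ.starProjection (x - w) = Wᗮ.starProjection x := by
    have h0 : Wᗮ.starProjection w = 0 := by
      rw [Submodule.starProjection_apply_eq_zero_iff]
      exact W.le_orthogonal_orthogonal hw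
    rw [map_sub, h0, sub_zero]
  have hle := Wᗮ.norm_starProjection_apply_le (x - w)
  rw [hproj] at hle
  rw [W.norm_sq_eq_add_norm_sq_starProjection x]
  gcongr

theorem OrthonormalBasis.sum_norm_sq_starProjection [Fintype ι] [FiniteDimensional 𝕜 E]
    (b : OrthonormalBasis ι 𝕜 E) (W : Submodule 𝕜 E) :
    ∑ i, ‖W.starProjection (b i)‖ ^ 2 = Module.finrank 𝕜 W := by
  have key (i : ι) : ‖W.starProjection (b i)‖ ^ 2 =
      ∑ l, ‖inner 𝕜 (stdOrthonormalBasis 𝕜 W l : E) (b i)‖ ^ 2 := by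
    rw [Submodule.starProjection_apply, ← Submodule.coe_norm,
      ← (stdOrthonormalBasis 𝕜 W).sum_sq_norm_inner_right]
    simp
  simp_rw [key]
  rw [Finset.sum_comm]
  simp_rw [b.sum_sq_norm_inner_left]
  simp [← Submodule.coe_norm]

end Projection

theorem sum_tail_le_sum_mul_one_sub {d k : ℕ} (hk : k ≤ d) {lam p : Fin d → ℝ}
    (hlam : ∀ j, 0 ≤ lam j) (hmono : Antitone lam) (hp0 : ∀ j, 0 ≤ p j) (hp1 : ∀ j, p j ≤ 1)
    (hp : ∑ j, p j ≤ k) :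
    ∑ j ∈ Finset.univ.filter (fun j : Fin d => k ≤ (j : ℕ)), lam j ≤ ∑ j, lam j * (1 - p j) := by
  obtain ⟨c, hc, hhead, htail⟩ : ∃ c : ℝ, 0 ≤ c ∧ (∀ j : Fin d, (j : ℕ) < k → c ≤ lam j) ∧
      ∀ j : Fin d, k ≤ (j : ℕ) → lam j ≤ c := by
    rcases hk.lt_or_eq with h | rfl
    · exact ⟨lam ⟨k, h⟩, hlam _, fun j hj => hmono (Fin.le_def.2 hj.le),
        fun j hj => hmono (Fin.le_def.2 hj)⟩
    · exact ⟨0, le_rfl, fun j _ => hlam j, fun j hj => absurd j.isLt hj.not_gt⟩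
  have hcard : ∑ j : Fin d, (if k ≤ (j : ℕ) then (0 : ℝ) else 1) = k := by
    simp_rw [← not_lt, ite_not]
    rw [Finset.sum_boole, Fin.card_filter_val_lt, min_eq_right hk]
  have hterm (j : Fin d) : c * ((if k ≤ (j : ℕ) then 0 else 1) - p j) ≤
      lam j * (1 - p j) - if k ≤ (j : ℕ) then lam j else 0 := by
    split_ifs with h
    · nlinarith [mul_le_mul_of_nonneg_right (htail j h) (hp0 j)]
    · nlinarith [mul_le_mul_of_nonneg_right (hhead j (not_le.1 h)) (sub_nonneg.2 (hp1 j))]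
  have hsum := Finset.sum_le_sum fun j (_ : j ∈ Finset.univ) => hterm j
  rw [← Finset.mul_sum, Finset.sum_sub_distrib, Finset.sum_sub_distrib, hcard,
    ← Finset.sum_filter] at hsum
  linarith [mul_nonneg hc (sub_nonneg.2 hp)]

theorem trace_mul_sum_smul_vecMulVec_mul_conjTranspose {m n ι : Type*} [Fintype m] [Fintype n]
    [Fintype ι] (A : Matrix m n ℂ) (u : ι → n → ℂ) (c : ι → ℂ) :
    trace (A * (∑ j, c j • vecMulVec (u j) (star (u j))) * Aᴴ) =
      ∑ j, c j * ((A *ᵥ u j) ⬝ᵥ star (A *ᵥ u j)) := by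
  simp only [Matrix.mul_sum, Matrix.sum_mul, trace_sum, Matrix.mul_smul, Matrix.smul_mul,
    trace_smul, smul_eq_mul, mul_vecMulVec, vecMulVec_mul, trace_vecMulVec, star_mulVec]

theorem sum_tail_le_sum_mul_norm_sub_sq {d k : ℕ}
    (b : OrthonormalBasis (Fin d) ℂ (EuclideanSpace ℂ (Fin d)))
    {lam : Fin d → ℝ} (hlam : ∀ j, 0 ≤ lam j) (hmono : Antitone lam) (hk : k ≤ d)
    {T : Matrix (Fin d) (Fin d) ℂ} (hT : T.rank ≤ k) :
    ∑ j ∈ Finset.univ.filter (fun j : Fin d => k ≤ (j : ℕ)), lam j ≤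
      ∑ j, lam j * ‖b j - toLpLin 2 2 T (b j)‖ ^ 2 := by
  let W := LinearMap.range (toLpLin 2 2 T)
  have hW : Module.finrank ℂ W = T.rank := by
    rw [T.rank_eq_finrank_range_toLin (PiLp.basisFun 2 ℂ (Fin d)) (PiLp.basisFun 2 ℂ (Fin d)),
      ← toLpLin_eq_toLin]
  refine (sum_tail_le_sum_mul_one_sub (p := fun j => ‖W.starProjection (b j)‖ ^ 2) hk hlam hmono
    (fun j => by positivity) (fun j => ?_) ?_).trans
    (Finset.sum_le_sum fun j _ => mul_le_mul_of_nonneg_left ?_ (hlam j))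
  · have h := W.norm_starProjection_apply_le (b j)
    rw [b.norm_eq_one] at h
    exact pow_le_one₀ (norm_nonneg _) h
  · rw [b.sum_norm_sq_starProjection, hW]
    exact_mod_cast hT
  · have h := norm_sq_le_norm_sq_starProjection_add W (b j) (LinearMap.mem_range_self _ (b j))
    rw [b.norm_eq_one] at h
    linarith

/-- Pointwise PCA optimality: with `u₁, …, u_d` an orthonormal basis of `ℂ^d`,
`λ₁ ≥ ⋯ ≥ λ_d ≥ 0`, and `f = Σ_j λ_j u_j u_jᴴ`, every `d × d` matrix `T` of rank at most `k`
satisfies `Re(trace((I − T) f (I − T)ᴴ)) ≥ Σ_{j > k} λ_j`, and the orthogonal projection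
`T = Σ_{j ≤ k} u_j u_jᴴ` attains this minimum value. -/
theorem stmt10 (d : ℕ) (u : Fin d → (Fin d → ℂ))
    (hortho : ∀ i j : Fin d, star (u i) ⬝ᵥ u j = if i = j then (1 : ℂ) else 0)
    (lam : Fin d → ℝ) (hlam : ∀ j, 0 ≤ lam j)
    (hmono : ∀ i j : Fin d, i ≤ j → lam j ≤ lam i)
    (f : Matrix (Fin d) (Fin d) ℂ)
    (hf : f = ∑ j, (lam j : ℂ) • Matrix.vecMulVec (u j) (star (u j)))
    (k : ℕ) (hk : k ≤ d) :
    (∀ T : Matrix (Fin d) (Fin d) ℂ, T.rank ≤ k →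
      (∑ j ∈ Finset.univ.filter (fun j : Fin d => k ≤ (j : ℕ)), lam j) ≤
        (Matrix.trace ((1 - T) * f * (1 - T)ᴴ)).re) ∧
    Matrix.trace
        ((1 - ∑ j ∈ Finset.univ.filter (fun j : Fin d => (j : ℕ) < k),
            Matrix.vecMulVec (u j) (star (u j))) * f *
          (1 - ∑ j ∈ Finset.univ.filter (fun j : Fin d => (j : ℕ) < k),
            Matrix.vecMulVec (u j) (star (u j)))ᴴ)
      = ((∑ j ∈ Finset.univ.filter (fun j : Fin d => k ≤ (j : ℕ)), lam j : ℝ) : ℂ) := by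
  have hcard : Fintype.card (Fin d) = Module.finrank ℂ (EuclideanSpace ℂ (Fin d)) := by simp
  have hon : Orthonormal ℂ fun j => WithLp.toLp 2 (u j) := by
    rw [orthonormal_iff_ite]
    intro i j
    rw [EuclideanSpace.inner_toLp_toLp, dotProduct_comm, hortho]
  let b := OrthonormalBasis.mk hon (hon.linearIndependent.span_eq_top_of_card_eq_finrank' hcard).ge
  have hb (j : Fin d) : b j = WithLp.toLp 2 (u j) := by simp [b]
  subst hf
  constructor
  · intro T hT
    refine (sum_tail_le_sum_mul_norm_sub_sq b hlam hmono hk hT).trans_eq ?_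
    rw [trace_mul_sum_smul_vecMulVec_mul_conjTranspose, Complex.re_sum]
    refine Finset.sum_congr rfl fun j _ => ?_
    rw [Complex.re_ofReal_mul, hb, toLpLin_toLp, ← WithLp.toLp_sub, sub_mulVec, one_mulVec,
      ← EuclideanSpace.inner_toLp_toLp, ← @inner_self_eq_norm_sq ℂ]
    rfl
  · rw [trace_mul_sum_smul_vecMulVec_mul_conjTranspose,
      Finset.sum_filter (fun j : Fin d => k ≤ (j : ℕ)),
      Complex.ofReal_sum]
    refine Finset.sum_congr rfl fun j _ => ?_
    have hproj : (∑ i ∈ Finset.univ.filter (fun i : Fin d => (i : ℕ) < k),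
        vecMulVec (u i) (star (u i))) *ᵥ u j =
        if (j : ℕ) < k then u j else 0 := by
      simp [sum_mulVec, vecMulVec_mulVec, hortho, apply_ite (MulOpposite.op), ite_smul]
    have hunit : u j ⬝ᵥ star (u j) = 1 := by rw [dotProduct_comm, hortho, if_pos rfl]
    rw [sub_mulVec, one_mulVec, hproj]
    by_cases h : (j : ℕ) < k
    · simp [h, h.not_ge]
    · simp [h, not_lt.1 h, hunit]
end

section
/- Define c : [−π,π] → ℝ by c(ω) = √( (1 − (2/9)(1 + cos 3ω)) / (1 + 4(1 + cos 3ω)) ). Then there do NOT exist complex numbers d₁, d₂, h₁, h₂ such that for almost every ω ∈ [−π,π], (d₁ + d₂e^{−3iω})·conj(h₁ + h₂e^{−3iω}) = (1/3)·(e^{−iω} + e^{i2ω})·c(ω)·(2 + e^{−3iω}). -/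
open MeasureTheory Real

/-- Non-existence of a one-sided refactorization in the candidate type (3) example: with
`c(ω) = √((1 − (2/9)(1 + cos 3ω))/(1 + 4(1 + cos 3ω)))`, there are no complex numbers
`d₁, d₂, h₁, h₂` such that for almost every `ω ∈ [−π, π]`,
`(d₁ + d₂ e^{−3iω}) conj(h₁ + h₂ e^{−3iω}) = (1/3)(e^{−iω} + e^{i2ω}) c(ω) (2 + e^{−3iω})`. -/
theorem stmt17 (c : ℝ → ℝ)
    (hc : ∀ ω : ℝ, c ω = Real.sqrt
      ((1 - (2 / 9) * (1 + Real.cos (3 * ω))) / (1 + 4 * (1 + Real.cos (3 * ω))))) :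
    ¬ ∃ d₁ d₂ h₁ h₂ : ℂ,
      ∀ᵐ (ω : ℝ) ∂(volume.restrict (Set.Icc (-π) π)),
        (d₁ + d₂ * Complex.exp (-3 * Complex.I * (ω : ℂ))) *
            (starRingEnd ℂ) (h₁ + h₂ * Complex.exp (-3 * Complex.I * (ω : ℂ)))
          = (1 / 3) *
              (Complex.exp (-Complex.I * (ω : ℂ)) + Complex.exp (2 * Complex.I * (ω : ℂ))) *
              ((c ω : ℂ)) * (2 + Complex.exp (-3 * Complex.I * (ω : ℂ))) := by
  rintro ⟨d₁, d₂, h₁, h₂, h⟩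
  have hc_cont : Continuous c := by
    rw [funext hc]
    refine Real.continuous_sqrt.comp (Continuous.div (by fun_prop) (by fun_prop) fun ω => ?_)
    linarith [Real.neg_one_le_cos (3 * ω)]
  have hconj : Continuous (starRingEnd ℂ) := Complex.continuous_conj
  have heq := Measure.eqOn_Icc_of_ae_eq volume (by linarith [Real.pi_pos] : -π ≠ π) h
    (by fun_prop) (by fun_prop)
  have h0 := heq (x := 0) ⟨by linarith [Real.pi_pos], Real.pi_pos.le⟩
  have h1 := heq (x := 2 * π / 3) ⟨by linarith [Real.pi_pos], by linarith [Real.pi_pos]⟩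
  have hc0 : 0 < c 0 := by
    rw [hc]
    apply Real.sqrt_pos.2
    norm_num
  have hc1 : c (2 * π / 3) = c 0 := by
    rw [hc, hc, show 3 * (2 * π / 3) = 2 * π by ring]
    simp
  have e1 : Complex.exp (-3 * Complex.I * ((2 * π / 3 : ℝ) : ℂ)) = 1 :=
    Complex.exp_eq_one_iff.2 ⟨-1, by push_cast; ring⟩
  have e2 : Complex.exp (2 * Complex.I * ((2 * π / 3 : ℝ) : ℂ)) =
      Complex.exp (-Complex.I * ((2 * π / 3 : ℝ) : ℂ)) :=
    Complex.exp_eq_exp_iff_exists_int.2 ⟨1, by push_cast; ring⟩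
  simp only [e1, e2, hc1] at h1
  simp only [Complex.ofReal_zero, mul_zero, Complex.exp_zero] at h0
  simp only [mul_one] at h0 h1
  rw [h0] at h1
  have hc0' : (c 0 : ℂ) ≠ 0 := by exact_mod_cast hc0.ne'
  have hz : Complex.exp (-Complex.I * ((2 * π / 3 : ℝ) : ℂ)) = 1 := by
    apply mul_left_cancel₀ hc0'
    linear_combination -h1 / 2
  obtain ⟨n, hn⟩ := Complex.exp_eq_one_iff.1 hz
  have him := congrArg Complex.im hn
  simp at him
  have hn3 : (3 * n : ℝ) = -1 := by
    apply mul_right_cancel₀ Real.pi_ne_zero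
    linarith
  have : 3 * n = -1 := by exact_mod_cast hn3
  omega
end
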